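/- arXiv:1202.3531 — 3 statements merged into one kernel-verified Lean document; each statement's English description precedes it below -/
import Mathlib

section
/- Let n = n₁·n₂, let S₂ ⊆ {0, …, n−1} be an n₂-periodic subset, and let C = D* I_{S₂} D ∈ ℂ^{n×n}, where I_{S₂} is the diagonal matrix with (I_{S₂})_{jj} = 1 if j ∈ S₂ and 0 otherwise. Then C_{ij} = 0 for every pair (i, j) with i ≢ j (mod n₁). -/
open scoped Matrix BigOperators

/-- The unitary DFT matrix: `D j k = exp(−2πi·jk/n)/√n`. -/
noncomputable def dft (n : ℕ) : Matrix (Fin n) (Fin n) ℂ :=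
  fun j k =>
    Complex.exp (-2 * (Real.pi : ℂ) * Complex.I * ((j : ℕ) : ℂ) * ((k : ℕ) : ℂ) / (n : ℂ)) /
      (Real.sqrt n : ℂ)

/-- A subset `S ⊆ {0, …, n−1}` is `l`-periodic if `l ∣ n` and membership in `S`
only depends on the residue mod `l`. -/
def IsPeriodicSubset (n l : ℕ) (S : Finset (Fin n)) : Prop :=
  l ∣ n ∧ ∀ i j : Fin n, (i : ℕ) % l = (j : ℕ) % l → (i ∈ S ↔ j ∈ S)

/-- The 0/1 diagonal matrix of a subset `S`. -/
def diagInd {n : ℕ} (S : Finset (Fin n)) : Matrix (Fin n) (Fin n) ℂ :=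
  Matrix.diagonal (fun j => if j ∈ S then (1 : ℂ) else 0)

/-- Shifting the row index of the DFT matrix by `n₂` (cyclically) multiplies column `k` by
`exp(−2πi·k/n₁)`, where `n = n₁·n₂`. -/
theorem dft_row_shift {n n₁ n₂ : ℕ} (hn : n = n₁ * n₂) (a b k : Fin n)
    (hb : (b : ℕ) = ((a : ℕ) + n₂) % n) :
    dft n b k =
      Complex.exp (-2 * (Real.pi : ℂ) * Complex.I * ((k : ℕ) : ℂ) / (n₁ : ℂ)) * dft n a k := by
  have hpos : n ≠ 0 := by have := a.isLt; omega
  have h₁ : (n₁ : ℂ) ≠ 0 := by rintro h; simp_all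
  have h₂ : (n₂ : ℂ) ≠ 0 := by rintro h; simp_all
  have hq : ((a : ℕ) : ℂ) + n₂ = ((b : ℕ) : ℂ) + n₁ * n₂ * (((a : ℕ) + n₂) / n : ℕ) := by
    have h := Nat.mod_add_div ((a : ℕ) + n₂) n
    rw [← hb] at h
    nth_rewrite 2 [hn] at h
    exact_mod_cast h.symm
  unfold dft
  rw [← mul_div_assoc, ← Complex.exp_add]
  congr 1
  rw [Complex.exp_eq_exp_iff_exists_int]
  refine ⟨((((a : ℕ) + n₂) / n * (k : ℕ) : ℕ) : ℤ), ?_⟩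
  have hb' := eq_sub_of_add_eq hq.symm
  rw [hb']
  have hnC : (n : ℂ) = n₁ * n₂ := by exact_mod_cast hn
  generalize (((a : ℕ) + n₂) / n : ℕ) = q
  rw [hnC]
  push_cast
  field_simp
  ring

/-- The phases `exp(−2πi·a/m)` and `exp(−2πi·b/m)` differ when `a ≢ b (mod m)`. -/
theorem star_exp_mul_exp_ne_one {m a b : ℕ} (hm : m ≠ 0) (hab : a % m ≠ b % m) :
    star (Complex.exp (-2 * (Real.pi : ℂ) * Complex.I * (a : ℂ) / (m : ℂ))) *
      Complex.exp (-2 * (Real.pi : ℂ) * Complex.I * (b : ℂ) / (m : ℂ)) ≠ 1 := by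
  intro h
  have hmC : (m : ℂ) ≠ 0 := by exact_mod_cast hm
  have hpi : (Real.pi : ℂ) ≠ 0 := by exact_mod_cast Real.pi_ne_zero
  rw [Complex.star_def, ← Complex.exp_conj, ← Complex.exp_add, Complex.exp_eq_one_iff] at h
  obtain ⟨q, hq⟩ := h
  simp only [map_div₀, map_mul, map_neg, Complex.conj_ofReal, Complex.conj_I, map_natCast,
    map_ofNat] at hq
  have hI := Complex.I_ne_zero
  have key : (a : ℂ) - b = m * q := by
    field_simp at hq
    linear_combination hq
  have keyZ : (a : ℤ) - b = m * q := by exact_mod_cast key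
  exact hab ((Nat.modEq_iff_dvd.2 ⟨q, keyZ⟩ : b ≡ a [MOD m]).symm)

/-- If `S₂` is an `n₂`-periodic subset with `n = n₁·n₂`, then `C = D* I_{S₂} D`
satisfies `C i j = 0` whenever `i ≢ j (mod n₁)`. -/
theorem dft_conj_periodic_entries_zero (n n₁ n₂ : ℕ) (hn : n = n₁ * n₂)
    (S₂ : Finset (Fin n)) (hS₂ : IsPeriodicSubset n n₂ S₂) :
    ∀ i j : Fin n, (i : ℕ) % n₁ ≠ (j : ℕ) % n₁ →
      ((dft n)ᴴ * diagInd S₂ * dft n) i j = 0 := by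
  intro i j hij
  have hpos : n ≠ 0 := by have := i.isLt; omega
  have : NeZero n := ⟨hpos⟩
  have h₁ : n₁ ≠ 0 := by rintro rfl; simp_all
  set σ : Equiv.Perm (Fin n) := Equiv.addRight (Fin.ofNat n n₂)
  have hσ : ∀ k, ((σ k : Fin n) : ℕ) = ((k : ℕ) + n₂) % n := by
    intro k
    simp [σ, Fin.val_add]
  have hmem : ∀ k, σ k ∈ S₂ ↔ k ∈ S₂ := by
    intro k
    refine hS₂.2 _ _ ?_
    rw [hσ, Nat.mod_mod_of_dvd _ hS₂.1, Nat.add_mod_right]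
  rw [diagInd, Matrix.mul_apply]
  simp only [Matrix.mul_diagonal, Matrix.conjTranspose_apply]
  have hsum := Equiv.sum_comp σ
    (fun k => star (dft n k i) * (if k ∈ S₂ then (1 : ℂ) else 0) * dft n k j)
  simp only [hmem, dft_row_shift hn _ _ _ (hσ _), star_mul'] at hsum
  have hω := star_exp_mul_exp_ne_one h₁ hij
  generalize Complex.exp (-2 * (Real.pi : ℂ) * Complex.I * ((i : ℕ) : ℂ) / (n₁ : ℂ)) = u at *
  generalize Complex.exp (-2 * (Real.pi : ℂ) * Complex.I * ((j : ℕ) : ℂ) / (n₁ : ℂ)) = v at *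
  have hfix : (star u * v) *
      ∑ k, star (dft n k i) * (if k ∈ S₂ then (1 : ℂ) else 0) * dft n k j =
      ∑ k, star (dft n k i) * (if k ∈ S₂ then (1 : ℂ) else 0) * dft n k j := by
    rw [Finset.mul_sum]
    refine Eq.trans (Finset.sum_congr rfl fun k _ => ?_) hsum
    ring
  by_contra hne
  exact hω (mul_right_cancel₀ hne (by rw [hfix, one_mul]))
end

section
/- Let n = n₁·n₂, let S₁ be an n₁-periodic subset and S₂ an n₂-periodic subset of {0, …, n−1}, and let C = D* I_{S₂} D, where I_{S₂} is the diagonal matrix with (I_{S₂})_{jj} = 1 if j ∈ S₂ and 0 otherwise. Then for every x ∈ ℂⁿ with x_j = 0 for all j ∈ S₁ (i.e., x supported on the complement of S₁), one has (Cx)_i = 0 for every i ∈ S₁. -/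
open scoped Matrix BigOperators

/-- The sum of `ζ ^ j` over an `l`-periodic subset vanishes if `ζ ^ n = 1` but `ζ ^ l ≠ 1`. -/
theorem sum_pow_eq_zero_of_isPeriodicSubset {n l : ℕ} [NeZero n] {S : Finset (Fin n)}
    (hS : IsPeriodicSubset n l S) {R : Type*} [CommRing R] [IsDomain R] {ζ : R} (hn : ζ ^ n = 1)
    (hl : ζ ^ l ≠ 1) : ∑ j : Fin n, (if j ∈ S then ζ ^ (j : ℕ) else 0) = 0 := by
  obtain ⟨hdvd, hmem⟩ := hS
  have hval (j : Fin n) : ((j + Fin.ofNat n l : Fin n) : ℕ) = (j + l) % n := by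
    simp [Fin.val_add]
  have hshift (j : Fin n) :
      (if j + Fin.ofNat n l ∈ S then ζ ^ ((j + Fin.ofNat n l : Fin n) : ℕ) else 0) =
        ζ ^ l * (if j ∈ S then ζ ^ (j : ℕ) else 0) := by
    have hiff : j + Fin.ofNat n l ∈ S ↔ j ∈ S := by
      apply hmem
      rw [hval, Nat.mod_mod_of_dvd _ hdvd, Nat.add_mod_right]
    simp only [hiff, hval, ← pow_eq_pow_mod _ hn, pow_add]
    split_ifs <;> ring
  have hsum := Equiv.sum_comp (Equiv.addRight (Fin.ofNat n l))
    (fun j => if j ∈ S then ζ ^ (j : ℕ) else 0)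
  have hmul := (Fintype.sum_congr _ _ hshift).symm.trans hsum
  rw [← Finset.mul_sum] at hmul
  by_contra h
  exact hl (mul_right_cancel₀ h (hmul.trans (one_mul _).symm))

/-- The entries of `D* I_S D` as sums of powers of a root of unity. -/
theorem dft_conj_diagInd_apply {n : ℕ} (S : Finset (Fin n)) (i k : Fin n) :
    ((dft n)ᴴ * diagInd S * dft n) i k =
      (∑ j : Fin n, if j ∈ S then
        Complex.exp (2 * Real.pi * Complex.I * (((i : ℕ) : ℂ) - ((k : ℕ) : ℂ)) / n) ^ (j : ℕ)
        else 0) / ((Real.sqrt n : ℂ) * (Real.sqrt n : ℂ)) := by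
  rw [diagInd, Matrix.mul_apply, Finset.sum_div]
  refine Finset.sum_congr rfl fun j _ => ?_
  rw [Matrix.mul_diagonal, Matrix.conjTranspose_apply]
  split_ifs
  · rw [mul_one, dft, dft, star_div₀, div_mul_div_comm, ← Complex.exp_nat_mul]
    simp only [Complex.star_def, ← Complex.exp_conj, Complex.conj_ofReal, ← Complex.exp_add,
      map_div₀, map_mul, map_neg, Complex.conj_I, map_natCast, map_ofNat]
    congr 2
    ring
  · simp

/-- `exp (2πi(a - b) / m) = 1` only if `a` and `b` are congruent mod `m`. -/
theorem mod_eq_of_exp_eq_one {m a b : ℕ} (hm : m ≠ 0)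
    (h : Complex.exp (2 * Real.pi * Complex.I * ((a : ℂ) - (b : ℂ)) / m) = 1) :
    a % m = b % m := by
  obtain ⟨z, hz⟩ := Complex.exp_eq_one_iff.mp h
  have hm' : (m : ℂ) ≠ 0 := by exact_mod_cast hm
  have hab : (a : ℂ) - b = z * m := by
    apply mul_left_cancel₀ Complex.two_pi_I_ne_zero
    rw [div_eq_iff hm'] at hz
    linear_combination hz
  have hab' : (a : ℤ) - b = z * m := by exact_mod_cast hab
  exact ((Nat.modEq_iff_dvd.mpr ⟨z, by rw [hab', mul_comm]⟩ : b ≡ a [MOD m])).symm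

/-- If `S₁` is `n₁`-periodic and `S₂` is `n₂`-periodic with `n = n₁·n₂`, and `x`
is supported on the complement of `S₁`, then `(D* I_{S₂} D x)ᵢ = 0` for all `i ∈ S₁`. -/
theorem dft_conj_periodic_support (n n₁ n₂ : ℕ) (hn : n = n₁ * n₂)
    (S₁ S₂ : Finset (Fin n))
    (hS₁ : IsPeriodicSubset n n₁ S₁) (hS₂ : IsPeriodicSubset n n₂ S₂) :
    ∀ x : Fin n → ℂ, (∀ j ∈ S₁, x j = 0) →
      ∀ i ∈ S₁, ((dft n)ᴴ * diagInd S₂ * dft n).mulVec x i = 0 := by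
  intro x hx i hi
  have hn0 : n ≠ 0 := i.pos.ne'
  have : NeZero n := ⟨hn0⟩
  have hn₁ : n₁ ≠ 0 := by rintro rfl; simp at hn; exact hn0 hn
  have hn₂ : n₂ ≠ 0 := by rintro rfl; simp at hn; exact hn0 hn
  have hn0' : (n : ℂ) ≠ 0 := by exact_mod_cast hn0
  have hn₁' : (n₁ : ℂ) ≠ 0 := by exact_mod_cast hn₁
  have hn₂' : (n₂ : ℂ) ≠ 0 := by exact_mod_cast hn₂
  rw [Matrix.mulVec, dotProduct]
  refine Finset.sum_eq_zero fun k _ => ?_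
  by_cases hik : (i : ℕ) % n₁ = (k : ℕ) % n₁
  · rw [hx k ((hS₁.2 i k hik).mp hi), mul_zero]
  · rw [dft_conj_diagInd_apply, sum_pow_eq_zero_of_isPeriodicSubset hS₂, zero_div, zero_mul]
    · rw [← Complex.exp_nat_mul, Complex.exp_eq_one_iff]
      refine ⟨(i : ℕ) - (k : ℕ), ?_⟩
      rw [mul_div_cancel₀ _ hn0']
      push_cast
      ring
    · refine fun h => hik (mod_eq_of_exp_eq_one hn₁ ?_)
      rw [← h, ← Complex.exp_nat_mul]
      congr 1
      have hncast : (n : ℂ) = n₁ * n₂ := by exact_mod_cast hn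
      rw [hncast]
      field_simp
end

section
/- Let g be a standard real Gaussian random variable (mean 0, variance 1). Then for every c ≥ √2 and every t ≥ 0, P(g > t + c) ≤ 2·exp(−t²/2)·P(g > c). Equivalently, the conditional random variable z = g − c·sgn(g) given |g| ≥ c satisfies P(|z| > t) ≤ 2·exp(−t²/2) for all t ≥ 0. -/
open MeasureTheory ProbabilityTheory

/-- Lowering the mean from `0` to `-t` multiplies the standard Gaussian density at `x ≥ 0` by at
most `exp (-t ^ 2 / 2)`. -/
lemma gaussianPDF_neg_mean_le {t x : ℝ} (ht : 0 ≤ t) (hx : 0 ≤ x) :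
    gaussianPDF (-t) 1 x ≤ ENNReal.ofReal (Real.exp (-t ^ 2 / 2)) * gaussianPDF 0 1 x := by
  rw [gaussianPDF, gaussianPDF, ← ENNReal.ofReal_mul (Real.exp_pos _).le]
  apply ENNReal.ofReal_le_ofReal
  rw [gaussianPDFReal, gaussianPDFReal, mul_left_comm, ← Real.exp_add]
  gcongr
  simp only [NNReal.coe_one]
  nlinarith [mul_nonneg ht hx]

/-- A Gaussian tail at a nonnegative level `c` decays at least by `exp (-t ^ 2 / 2)` when the level
is raised by `t ≥ 0`. -/
lemma gaussianReal_shifted_tail_le {c t : ℝ} (hc : 0 ≤ c) (ht : 0 ≤ t) :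
    gaussianReal 0 1 {x | t + c < x} ≤
      ENNReal.ofReal (Real.exp (-t ^ 2 / 2)) * gaussianReal 0 1 {x | c < x} := by
  have hshift : gaussianReal 0 1 {x | t + c < x} = gaussianReal (-t) 1 {x | c < x} := by
    rw [← zero_sub t, ← gaussianReal_map_sub_const t,
      Measure.map_apply (by fun_prop) (measurableSet_lt measurable_const measurable_id')]
    simp only [Set.preimage_ofPred_eq, lt_sub_iff_add_lt']
  rw [hshift, gaussianReal_apply _ one_ne_zero, gaussianReal_apply _ one_ne_zero,
    ← lintegral_const_mul _ (measurable_gaussianPDF 0 1)]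
  exact setLIntegral_mono' measurableSet_Ioi fun x hx ↦
    gaussianPDF_neg_mean_le ht (hc.trans (le_of_lt hx))

/-- Gaussian tail estimate: for a standard real Gaussian `g`, every `c ≥ √2` and
every `t ≥ 0`, `P(g > t + c) ≤ 2·exp(−t²/2)·P(g > c)`. -/
theorem gaussian_conditional_tail (c t : ℝ) (hc : Real.sqrt 2 ≤ c) (ht : 0 ≤ t) :
    gaussianReal 0 1 {x | t + c < x} ≤
      ENNReal.ofReal (2 * Real.exp (-t ^ 2 / 2)) * gaussianReal 0 1 {x | c < x} := by
  refine (gaussianReal_shifted_tail_le ((Real.sqrt_nonneg 2).trans hc) ht).trans ?_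
  gcongr
  linarith [Real.exp_pos (-t ^ 2 / 2)]
end
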